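/- There exists N such that for every integer n ≥ N with n ≡ 3, 5, 24, or 26 (mod 28), the number of isomorphism classes of cyclic (K_{10n+5}, C_5)-designs satisfies NC(10n+5, 5) ≥ 38.4^n. -/

import Mathlib

namespace CCS

/-- A block: a set of edges of the complete graph on `ZMod v`. -/
abbrev Block (v : ℕ) := Finset (Sym2 (ZMod v))

/-- The edge set of the closed tuple `c = (c 0, c 1, …, c (k-1))`. -/
def edgesOf {v k : ℕ} (c : Fin k → ZMod v) : Block v :=
  Finset.image (fun i : Fin k => s(c i, c ⟨(i.1 + 1) % k, Nat.mod_lt _ i.pos⟩)) Finset.univ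

/-- `E` is the edge set of a `k`-cycle on `ZMod v`. Since for `k ≥ 3` the edge set
determines the closed tuple up to rotation and reversal, a `k`-cycle is identified
with its edge set. -/
def IsCycleBlock (v k : ℕ) (E : Block v) : Prop :=
  ∃ c : Fin k → ZMod v, Function.Injective c ∧ E = edgesOf c

/-- The translate `E + z` of a cycle. -/
def translateBlock {v : ℕ} (E : Block v) (z : ZMod v) : Block v :=
  E.image (Sym2.map (· + z))

/-- A `(K_v, C_k)`-design: a set of `k`-cycles whose edge sets partition the edges of `K_v`. -/
def IsDesign (v k : ℕ) (B : Set (Block v)) : Prop :=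
  (∀ E ∈ B, IsCycleBlock v k E) ∧
  ∀ e : Sym2 (ZMod v), ¬ e.IsDiag → ∃! E, E ∈ B ∧ e ∈ E

/-- A cyclic `(K_v, C_k)`-design. -/
def IsCyclicDesign (v k : ℕ) (B : Set (Block v)) : Prop :=
  IsDesign v k B ∧ ∀ E ∈ B, ∀ z : ZMod v, translateBlock E z ∈ B

/-- Two designs are isomorphic if a bijection of `ZMod v` maps one onto the other. -/
def Isomorphic {v : ℕ} (B B' : Set (Block v)) : Prop :=
  ∃ f : ZMod v ≃ ZMod v, B' = (fun E : Block v => E.image (Sym2.map f)) '' B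

/-- `NC v k`: the number of cyclic `(K_v, C_k)`-designs up to isomorphism. -/
noncomputable def NC (v k : ℕ) : ℕ :=
  Nat.card (Quot fun B B' : {B : Set (Block v) // IsCyclicDesign v k B} =>
    Isomorphic B.1 B'.1)

/-- The type of a cycle: the order of its stabilizer under translations. -/
noncomputable def cycleType {v : ℕ} (E : Block v) : ℕ :=
  Nat.card {z : ZMod v // translateBlock E z = E}

/-- The two differences `±(a-b)` arising from an edge `{a,b}`. -/
def edgeDiffs {v : ℕ} : Sym2 (ZMod v) → Multiset (ZMod v) :=
  Sym2.lift ⟨fun a b => {a - b, b - a}, fun a b => by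
    show (a-b) ::ₘ {b-a} = (b-a) ::ₘ {a-b}; exact Multiset.cons_swap _ _ _⟩

/-- The multiset of the `2k` differences arising from the `k` edges of a cycle.
For a cycle of type `d` this is `d` copies of the list `∂C` of partial differences. -/
def fullDiffs {v : ℕ} (E : Block v) : Multiset (ZMod v) :=
  E.val.bind edgeDiffs

/-- The multiset `∂C` of partial differences of a cycle: each difference is counted
with multiplicity equal to its multiplicity among the `2k` edge differences divided
by the type of the cycle. -/
noncomputable def partialDiffs {v : ℕ} (E : Block v) : Multiset (ZMod v) :=
  (fullDiffs E).toFinset.val.bind fun x =>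
    Multiset.replicate ((fullDiffs E).count x / cycleType E) x

/-- A `(K_v, C_k)`-difference system: a set of `k`-cycles whose partial differences
cover every nonzero element of `ZMod v` exactly once. -/
def IsDifferenceSystem (v k : ℕ) (F : Finset (Block v)) : Prop :=
  (∀ E ∈ F, IsCycleBlock v k E) ∧
  ∀ x : ZMod v, (F.val.bind partialDiffs).count x = if x = 0 then 0 else 1

end CCS

namespace CCS

section Isomorphism

variable {v : ℕ}

/-- The image of a set of blocks under a permutation of the vertices. -/
def permBlocks (f : Equiv.Perm (ZMod v)) (B : Set (Block v)) : Set (Block v) :=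
  (fun E : Block v => E.image (Sym2.map f)) '' B

lemma permBlocks_one (B : Set (Block v)) : permBlocks 1 B = B := by
  simp [permBlocks]

lemma permBlocks_mul (f g : Equiv.Perm (ZMod v)) (B : Set (Block v)) :
    permBlocks (f * g) B = permBlocks f (permBlocks g B) := by
  simp only [permBlocks, Set.image_image, Finset.image_image, Equiv.Perm.coe_mul, Sym2.map_comp]

lemma isomorphic_iff {B B' : Set (Block v)} : Isomorphic B B' ↔ ∃ f, B' = permBlocks f B :=
  Iff.rfl

lemma isomorphic_equivalence : Equivalence (Isomorphic (v := v)) where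
  refl B := isomorphic_iff.2 ⟨1, (permBlocks_one B).symm⟩
  symm := by
    simp only [isomorphic_iff]
    rintro B _ ⟨f, rfl⟩
    exact ⟨f⁻¹, by rw [← permBlocks_mul, inv_mul_cancel, permBlocks_one]⟩
  trans := by
    simp only [isomorphic_iff]
    rintro B _ _ ⟨f, rfl⟩ ⟨g, rfl⟩
    exact ⟨g * f, by rw [permBlocks_mul]⟩

lemma translateBlock_translateBlock (E : Block v) (y z : ZMod v) :
    translateBlock (translateBlock E y) z = translateBlock E (y + z) := by
  simp only [translateBlock, Finset.image_image, ← Sym2.map_comp]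
  congr 2
  ext x
  simp [add_assoc]

lemma translateBlock_zero (E : Block v) : translateBlock E 0 = E := by
  simp [translateBlock]

lemma permBlocks_addRight_of_isCyclicDesign {k : ℕ} {B : Set (Block v)}
    (hB : IsCyclicDesign v k B) (z : ZMod v) : permBlocks (Equiv.addRight z) B = B := by
  apply Set.Subset.antisymm
  · rintro _ ⟨E, hE, rfl⟩
    exact hB.2 E hE z
  · intro E hE
    refine ⟨translateBlock E (-z), hB.2 E hE _, ?_⟩
    change translateBlock (translateBlock E (-z)) z = E
    rw [translateBlock_translateBlock, neg_add_cancel, translateBlock_zero]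

/-- A permutation of `ZMod v` is determined by its value at `0` and the permutation to which it
conjugates the unit translation. -/
lemma perm_eq_of_conj_eq [NeZero v] {f g : Equiv.Perm (ZMod v)} (h0 : f 0 = g 0)
    (h : f⁻¹ * Equiv.addRight 1 * f = g⁻¹ * Equiv.addRight 1 * g) : f = g := by
  have hcomm : ∀ x, g (f⁻¹ (x + 1)) = g (f⁻¹ x) + 1 := by
    intro x
    have := congrArg (fun e : Equiv.Perm (ZMod v) => g (e (f⁻¹ x))) h
    simpa using this
  have hnat : ∀ k : ℕ, g (f⁻¹ (f 0 + k)) = f 0 + k := by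
    intro k
    induction k with
    | zero => simp [← h0]
    | succ k ih => rw [Nat.cast_succ, ← add_assoc, hcomm, ih]
  ext1 x
  have := hnat (f x - f 0).val
  rw [ZMod.natCast_zmod_val, add_sub_cancel, show f⁻¹ (f x) = x from f.symm_apply_apply x] at this
  exact this.symm

/-- At most `v` cyclic designs are isomorphic to a given set of blocks. -/
lemma card_isomorphic_le [NeZero v] (k : ℕ) (B : Set (Block v)) :
    Nat.card {B' : {B : Set (Block v) // IsCyclicDesign v k B} // Isomorphic B B'.1} ≤ v := by
  classical
  set T := {B' : {B : Set (Block v) // IsCyclicDesign v k B} // Isomorphic B B'.1}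
  set H := {h : Equiv.Perm (ZMod v) // permBlocks h B = B}
  choose f hf using fun t : T => isomorphic_iff.1 t.2
  have himage : ∀ (t : T) (h : H), permBlocks (f t * h.1) B = t.1.1 := by
    intro t h
    rw [permBlocks_mul, h.2, ← hf]
  have hconj : ∀ (t : T) (h : H),
      permBlocks ((f t * h.1)⁻¹ * Equiv.addRight 1 * (f t * h.1)) B = B := by
    intro t h
    rw [permBlocks_mul, himage, permBlocks_mul, permBlocks_addRight_of_isCyclicDesign t.1.2,
      ← himage t h, ← permBlocks_mul, inv_mul_cancel, permBlocks_one]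
  let φ : T × H → ZMod v × H := fun p => ((f p.1 * p.2.1) 0, ⟨_, hconj p.1 p.2⟩)
  have hφ : Function.Injective φ := by
    rintro ⟨t, h⟩ ⟨t', h'⟩ heq
    obtain ⟨h0, h1⟩ := Prod.mk.inj heq
    have hfg := perm_eq_of_conj_eq h0 (Subtype.mk.inj h1)
    have ht : t = t' := by
      apply Subtype.ext
      apply Subtype.ext
      rw [← himage t h, ← himage t' h', hfg]
    subst ht
    rw [show h = h' from Subtype.ext (mul_left_cancel hfg)]
  have hle := Nat.card_le_card_of_injective φ hφ
  rw [Nat.card_prod, Nat.card_prod, Nat.card_zmod] at hle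
  have : Nonempty H := ⟨⟨1, permBlocks_one B⟩⟩
  exact Nat.le_of_mul_le_mul_right hle Nat.card_pos

lemma card_isCyclicDesign_le [NeZero v] (k : ℕ) :
    Nat.card {B : Set (Block v) // IsCyclicDesign v k B} ≤ NC v k * v := by
  classical
  set D := {B : Set (Block v) // IsCyclicDesign v k B}
  set r : D → D → Prop := fun B B' => Isomorphic B.1 B'.1
  have hr : Equivalence r := isomorphic_equivalence.comap Subtype.val
  have := Fintype.ofFinite D
  have := Fintype.ofFinite (Quot r)
  have hfiber : ∀ q ∈ (Finset.univ : Finset (Quot r)),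
      (Finset.univ.filter fun B : D => Quot.mk r B = q).card ≤ v := by
    intro q _
    obtain ⟨B, rfl⟩ := Quot.exists_rep q
    refine le_trans (le_of_eq ?_) (card_isomorphic_le k B.1)
    rw [Nat.card_eq_fintype_card, Fintype.card_subtype]
    congr 1
    ext B'
    simp only [Finset.mem_filter, Finset.mem_univ, true_and]
    rw [eq_comm, Quot.eq, hr.eqvGen_iff]
  have := Finset.card_le_mul_card_image_of_maps_to
    (f := Quot.mk r) (s := Finset.univ) (t := Finset.univ) (fun _ _ => Finset.mem_univ _) v hfiber
  rw [NC, Nat.card_eq_fintype_card, Nat.card_eq_fintype_card, mul_comm]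
  simpa using this

end Isomorphism

section Family

variable {v : ℕ}

lemma edgesOf_five (c : Fin 5 → ZMod v) :
    edgesOf c = Finset.univ.image fun k : Fin 5 => s(c k, c (k + 1)) := rfl

lemma mem_translateBlock_edgesOf {c : Fin 5 → ZMod v} {z : ZMod v} {e : Sym2 (ZMod v)} :
    e ∈ translateBlock (edgesOf c) z ↔ ∃ k, e = s(c k + z, c (k + 1) + z) := by
  simp only [edgesOf_five, translateBlock, Finset.image_image, Finset.mem_image, Finset.mem_univ,
    true_and, Function.comp_apply, Sym2.map_mk, eq_comm]

lemma isCycleBlock_translateBlock {c : Fin 5 → ZMod v} (hc : Function.Injective c) (z : ZMod v) :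
    IsCycleBlock v 5 (translateBlock (edgesOf c) z) := by
  refine ⟨fun k => c k + z, fun _ _ h => hc (add_right_cancel h), ?_⟩
  ext e
  rw [mem_translateBlock_edgesOf]
  simp only [edgesOf_five, Finset.mem_image, Finset.mem_univ, true_and, eq_comm]

/-- The blocks obtained by developing a family of closed tuples. -/
def develop {ι : Type*} (c : ι → Fin 5 → ZMod v) : Set (Block v) :=
  {E | ∃ j z, E = translateBlock (edgesOf (c j)) z}

lemma isCyclicDesign_develop {ι : Type*} {c : ι → Fin 5 → ZMod v}
    (hinj : ∀ j, Function.Injective (c j))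
    (hex : ∀ d : ZMod v, d ≠ 0 → ∃ j k, c j (k + 1) - c j k = d ∨ c j (k + 1) - c j k = -d)
    (huniq : ∀ j k j' k' z z',
      s(c j k + z, c j (k + 1) + z) = s(c j' k' + z', c j' (k' + 1) + z') →
        translateBlock (edgesOf (c j)) z = translateBlock (edgesOf (c j')) z') :
    IsCyclicDesign v 5 (develop c) := by
  refine ⟨⟨?_, ?_⟩, ?_⟩
  · rintro _ ⟨j, z, rfl⟩
    exact isCycleBlock_translateBlock (hinj j) z
  · intro e
    induction e with | _ p q
    intro hpq
    have hd : q - p ≠ 0 := fun h => hpq (sub_eq_zero.1 h).symm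
    obtain ⟨j, k, h⟩ := hex _ hd
    have hz : ∃ z, s(p, q) = s(c j k + z, c j (k + 1) + z) := by
      rcases h with h | h
      · refine ⟨p - c j k, Sym2.eq_iff.2 (Or.inl ⟨by ring, ?_⟩)⟩
        linear_combination -h
      · refine ⟨q - c j k, Sym2.eq_iff.2 (Or.inr ⟨?_, by ring⟩)⟩
        linear_combination -h
    obtain ⟨z, hz⟩ := hz
    refine ⟨_, ⟨⟨j, z, rfl⟩, mem_translateBlock_edgesOf.2 ⟨k, hz⟩⟩, ?_⟩
    rintro _ ⟨⟨j', z', rfl⟩, he⟩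
    obtain ⟨k', hk'⟩ := mem_translateBlock_edgesOf.1 he
    exact huniq _ _ _ _ _ _ (hk'.symm.trans hz)
  · rintro _ ⟨j, y, rfl⟩ z
    exact ⟨j, y + z, translateBlock_translateBlock _ _ _⟩

lemma sub_eq_of_sym2_eq {p q p' q' z z' : ZMod v}
    (h : s(p + z, q + z) = s(p' + z', q' + z')) : q - p = q' - p' ∨ q - p = -(q' - p') := by
  rcases Sym2.eq_iff.1 h with ⟨h1, h2⟩ | ⟨h1, h2⟩
  · left; linear_combination h2 - h1
  · right; linear_combination h2 - h1

/-- A closed tuple which is a progression is invariant under translation by its step. -/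
lemma translateBlock_add_step {c : Fin 5 → ZMod v} {g : ZMod v}
    (hc : ∀ k, c (k + 1) = c k + g) (z : ZMod v) (l : ℕ) :
    translateBlock (edgesOf c) (z + l * g) = translateBlock (edgesOf c) z := by
  induction l with
  | zero => simp
  | succ l ih =>
    rw [← ih]
    ext e
    simp only [mem_translateBlock_edgesOf]
    constructor
    · rintro ⟨k, rfl⟩
      refine ⟨k + 1, ?_⟩
      rw [hc (k + 1), hc k]
      push_cast
      ring_nf
    · rintro ⟨k, rfl⟩
      refine ⟨k - 1, ?_⟩
      have := hc (k - 1)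
      rw [sub_add_cancel] at this
      rw [hc k, sub_add_cancel, this]
      push_cast
      ring_nf

/-- The translates of a cycle of type `5` which share an edge are equal. -/
lemma translateBlock_eq_of_progression {c : Fin 5 → ZMod v} {g : ZMod v} (hg : 5 * g = 0)
    (hc : ∀ k, c k = (k : ℕ) * g) {k k' : Fin 5} {z z' : ZMod v}
    (h : s(c k + z, c (k + 1) + z) = s(c k' + z', c (k' + 1) + z')) :
    translateBlock (edgesOf c) z = translateBlock (edgesOf c) z' := by
  have hstep : ∀ k, c (k + 1) = c k + g := by
    intro k
    rw [hc, hc]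
    fin_cases k <;> simp
    · ring
    · ring
    · ring
    · linear_combination -hg
  have key : ∃ l : ℕ, z = z' + l * g := by
    rcases Sym2.eq_iff.1 h with ⟨h1, -⟩ | ⟨h1, -⟩
    · rw [hc, hc] at h1
      refine ⟨k' + 4 * k, ?_⟩
      push_cast
      linear_combination h1 - (k : ℕ) * hg
    · rw [hstep, hc, hc] at h1
      refine ⟨k' + 1 + 4 * k, ?_⟩
      push_cast
      linear_combination h1 - (k : ℕ) * hg
  obtain ⟨l, rfl⟩ := key
  exact translateBlock_add_step hstep z' l

end Family

section Construction

variable {n : ℕ}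

/-- Vertices of the base cycles: `(0, a, -a, n, -x)` with `a = 2n+2+i` and `x = π i + 1`, and the
two cycles of type `5`. -/
def baseVertex (π : Equiv.Perm (Fin n)) : Fin n ⊕ Bool → Fin 5 → ℕ
  | .inl i => ![0, 2 * n + 2 + i, 8 * n + 3 - i, n, 10 * n + 4 - π i]
  | .inr true => ![0, 2 * n + 1, 4 * n + 2, 6 * n + 3, 8 * n + 4]
  | .inr false => ![0, 4 * n + 2, 8 * n + 4, 2 * n + 1, 6 * n + 3]

/-- The base cycles. -/
def baseCycle (π : Equiv.Perm (Fin n)) (j : Fin n ⊕ Bool) (k : Fin 5) : ZMod (10 * n + 5) :=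
  baseVertex π j k

/-- The representative in `[1, 5n+2]` of the difference of an edge of a base cycle. -/
def edgeLength (π : Equiv.Perm (Fin n)) : Fin n ⊕ Bool → Fin 5 → ℕ
  | .inl i => ![2 * n + 2 + i, min (4 * n + 4 + 2 * i) (6 * n + 1 - 2 * i), 3 * n + 2 + i,
      n + 1 + π i, π i + 1]
  | .inr true => fun _ => 2 * n + 1
  | .inr false => fun _ => 4 * n + 2

lemma edgeLength_le (π : Equiv.Perm (Fin n)) (j : Fin n ⊕ Bool) (k : Fin 5) :
    1 ≤ edgeLength π j k ∧ edgeLength π j k ≤ 5 * n + 2 := by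
  rcases j with i | _ | _
  · have := i.2
    have := (π i).2
    fin_cases k <;> simp [edgeLength] <;> omega
  all_goals simp [edgeLength]; try omega

lemma natCast_sub_natCast_eq {v A B L : ℕ}
    (h : B = A + L ∨ B + v = A + L ∨ A = B + L ∨ A + v = B + L) :
    (B : ZMod v) - A = L ∨ (B : ZMod v) - A = -L := by
  have hv : (v : ZMod v) = 0 := ZMod.natCast_self v
  rcases h with h | h | h | h <;> apply_fun ((↑) : ℕ → ZMod v) at h <;> push_cast at h
  · left; linear_combination h
  · left; linear_combination h - hv
  · right; linear_combination -h
  · right; linear_combination -h + hv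

lemma baseCycle_sub (π : Equiv.Perm (Fin n)) (j : Fin n ⊕ Bool) (k : Fin 5) :
    baseCycle π j (k + 1) - baseCycle π j k = edgeLength π j k ∨
      baseCycle π j (k + 1) - baseCycle π j k = -edgeLength π j k := by
  apply natCast_sub_natCast_eq
  rcases j with i | _ | _
  · have := i.2
    have := (π i).2
    fin_cases k <;> simp [edgeLength, baseVertex] <;> omega
  all_goals fin_cases k <;> simp [edgeLength, baseVertex] <;> omega

lemma natAbs_valMinAbs_baseCycle_sub (π : Equiv.Perm (Fin n)) (j : Fin n ⊕ Bool) (k : Fin 5) :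
    (baseCycle π j (k + 1) - baseCycle π j k).valMinAbs.natAbs = edgeLength π j k := by
  have hl : edgeLength π j k ≤ (10 * n + 5) / 2 := by
    have := (edgeLength_le π j k).2
    omega
  rcases baseCycle_sub π j k with h | h <;> rw [h] <;>
    simp [ZMod.valMinAbs_natCast_of_le_half hl]

lemma edgeLength_eq_of_sym2_eq {π π' : Equiv.Perm (Fin n)} {j j' : Fin n ⊕ Bool} {k k' : Fin 5}
    {z z' : ZMod (10 * n + 5)}
    (h : s(baseCycle π j k + z, baseCycle π j (k + 1) + z) =
      s(baseCycle π' j' k' + z', baseCycle π' j' (k' + 1) + z')) :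
    edgeLength π j k = edgeLength π' j' k' := by
  rw [← natAbs_valMinAbs_baseCycle_sub, ← natAbs_valMinAbs_baseCycle_sub]
  rcases sub_eq_of_sym2_eq h with h | h <;> rw [h]
  exact ZMod.natAbs_valMinAbs_neg _

lemma baseCycle_injective (π : Equiv.Perm (Fin n)) (j : Fin n ⊕ Bool) :
    Function.Injective (baseCycle π j) := by
  have hlt : ∀ k, baseVertex π j k < 10 * n + 5 := by
    intro k
    rcases j with i | _ | _
    · have := i.2
      fin_cases k <;> simp [baseVertex] <;> omega
    all_goals fin_cases k <;> simp [baseVertex] <;> omega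
  intro k k' h
  have h' : baseVertex π j k = baseVertex π j k' := by
    rw [baseCycle, baseCycle, ZMod.natCast_eq_natCast_iff'] at h
    rwa [Nat.mod_eq_of_lt (hlt k), Nat.mod_eq_of_lt (hlt k')] at h
  rcases j with i | _ | _
  · have := i.2
    have := (π i).2
    fin_cases k <;> fin_cases k' <;> simp [baseVertex] at h' ⊢ <;> omega
  all_goals fin_cases k <;> fin_cases k' <;> simp [baseVertex] at h' ⊢ <;> omega

lemma exists_edgeLength_eq (π : Equiv.Perm (Fin n)) {l : ℕ} (h1 : 1 ≤ l) (h2 : l ≤ 5 * n + 2) :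
    ∃ j k, edgeLength π j k = l := by
  have hmem : l ≤ n ∨ (n + 1 ≤ l ∧ l ≤ 2 * n) ∨ l = 2 * n + 1 ∨ (2 * n + 2 ≤ l ∧ l ≤ 3 * n + 1) ∨
      (3 * n + 2 ≤ l ∧ l ≤ 4 * n + 1) ∨ l = 4 * n + 2 ∨ (4 * n + 3 ≤ l ∧ l % 2 = 0) ∨
      (4 * n + 3 ≤ l ∧ l % 2 = 1) := by omega
  rcases hmem with h | h | h | h | h | h | h | h
  · refine ⟨.inl (π⁻¹ ⟨l - 1, by omega⟩), 4, ?_⟩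
    simp [edgeLength]; omega
  · refine ⟨.inl (π⁻¹ ⟨l - (n + 1), by omega⟩), 3, ?_⟩
    simp [edgeLength]; omega
  · exact ⟨.inr true, 0, h.symm⟩
  · refine ⟨.inl ⟨l - (2 * n + 2), by omega⟩, 0, ?_⟩
    simp [edgeLength]; omega
  · refine ⟨.inl ⟨l - (3 * n + 2), by omega⟩, 2, ?_⟩
    simp [edgeLength]; omega
  · exact ⟨.inr false, 0, h.symm⟩
  · refine ⟨.inl ⟨(l - (4 * n + 4)) / 2, by omega⟩, 1, ?_⟩
    simp [edgeLength]; omega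
  · refine ⟨.inl ⟨(6 * n + 1 - l) / 2, by omega⟩, 1, ?_⟩
    simp [edgeLength]; omega

lemma edgeLength_inj (π : Equiv.Perm (Fin n)) {j j' : Fin n ⊕ Bool} {k k' : Fin 5}
    (h : edgeLength π j k = edgeLength π j' k') : j = j' ∧ (k = k' ∨ ∃ b, j = .inr b) := by
  have hπ : ∀ i i' : Fin n, (π i : ℕ) = π i' → (i : ℕ) = i' := fun i i' h => by
    rw [π.injective (Fin.ext h)]
  rcases j with i | b <;> rcases j' with i' | b'
  · have := i.2
    have := i'.2
    have := (π i).2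
    have := (π i').2
    have := hπ i i'
    rw [Sum.inl.injEq, Fin.ext_iff]
    fin_cases k <;> fin_cases k' <;> simp [edgeLength] at h ⊢ <;> omega
  · have := i.2
    have := (π i).2
    cases b' <;> fin_cases k <;> simp [edgeLength] at h ⊢ <;> omega
  · have := i'.2
    have := (π i').2
    cases b <;> fin_cases k' <;> simp [edgeLength] at h ⊢ <;> omega
  · cases b <;> cases b' <;> simp [edgeLength] at h ⊢ <;> omega

lemma exists_baseCycle_inr_eq (π : Equiv.Perm (Fin n)) (b : Bool) :
    ∃ g : ZMod (10 * n + 5), 5 * g = 0 ∧ ∀ k, baseCycle π (.inr b) k = (k : ℕ) * g := by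
  have hv : (10 * n + 5 : ZMod (10 * n + 5)) = 0 := by
    exact_mod_cast ZMod.natCast_self (10 * n + 5)
  cases b
  · refine ⟨4 * n + 2, by linear_combination 2 * hv, fun k => ?_⟩
    fin_cases k <;> simp [baseCycle, baseVertex]
    · ring
    · linear_combination -hv
    · linear_combination -hv
  · refine ⟨2 * n + 1, by linear_combination hv, fun k => ?_⟩
    fin_cases k <;> simp [baseCycle, baseVertex] <;> ring

lemma isCyclicDesign_develop_baseCycle (π : Equiv.Perm (Fin n)) :
    IsCyclicDesign (10 * n + 5) 5 (develop (baseCycle π)) := by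
  apply isCyclicDesign_develop (baseCycle_injective π)
  · intro d hd
    have h1 : 1 ≤ d.valMinAbs.natAbs := by
      rw [Nat.one_le_iff_ne_zero, Int.natAbs_ne_zero, Ne, ZMod.valMinAbs_eq_zero]
      exact hd
    have h2 : d.valMinAbs.natAbs ≤ 5 * n + 2 := by
      have := ZMod.natAbs_valMinAbs_le d
      omega
    obtain ⟨j, k, h⟩ := exists_edgeLength_eq π h1 h2
    rw [← natAbs_valMinAbs_baseCycle_sub, ZMod.natAbs_valMinAbs_eq_natAbs_valMinAbs] at h
    exact ⟨j, k, h⟩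
  · intro j k j' k' z z' h
    obtain ⟨rfl, hk⟩ := edgeLength_inj π (edgeLength_eq_of_sym2_eq h)
    rcases hk with rfl | ⟨b, rfl⟩
    · rcases Sym2.eq_iff.1 h with ⟨h1, -⟩ | ⟨h1, h2⟩
      · rw [add_left_cancel h1]
      · exfalso
        have hpos := (edgeLength_le π j k).1
        refine ZMod.ne_neg_self (n := 10 * n + 5) ⟨5 * n + 2, by ring⟩
          (a := baseCycle π j (k + 1) - baseCycle π j k) (fun h0 => ?_)
          (by linear_combination h2 - h1)
        rw [← natAbs_valMinAbs_baseCycle_sub, h0] at hpos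
        simp at hpos
    · obtain ⟨g, hg, hc⟩ := exists_baseCycle_inr_eq π b
      exact translateBlock_eq_of_progression hg hc h

lemma develop_baseCycle_injective :
    Function.Injective fun π : Equiv.Perm (Fin n) => develop (baseCycle π) := by
  intro π π' h
  ext i
  have hmem : edgesOf (baseCycle π (.inl i)) ∈ develop (baseCycle π') := by
    rw [← show develop (baseCycle π) = develop (baseCycle π') from h]
    exact ⟨.inl i, 0, (translateBlock_zero _).symm⟩
  obtain ⟨j, z, hE⟩ := hmem
  have hlen : ∀ k, ∃ k', edgeLength π (.inl i) k = edgeLength π' j k' := by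
    intro k
    have hk : s(baseCycle π (.inl i) k + 0, baseCycle π (.inl i) (k + 1) + 0) ∈
        translateBlock (edgesOf (baseCycle π' j)) z := by
      rw [← hE, ← translateBlock_zero (edgesOf _), mem_translateBlock_edgesOf]
      exact ⟨k, rfl⟩
    obtain ⟨k', hk'⟩ := mem_translateBlock_edgesOf.1 hk
    exact ⟨k', edgeLength_eq_of_sym2_eq hk'⟩
  obtain ⟨k₀, h₀⟩ := hlen 0
  obtain ⟨k₄, h₄⟩ := hlen 4
  obtain ⟨rfl, -⟩ := edgeLength_inj π' (j := .inl i) (k := 0) h₀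
  have := i.2
  have := (π i).2
  have := (π' i).2
  fin_cases k₄ <;> simp [edgeLength] at h₄ ⊢ <;> omega

lemma factorial_le_NC_mul (n : ℕ) : n.factorial ≤ NC (10 * n + 5) 5 * (10 * n + 5) := by
  refine le_trans ?_ (card_isCyclicDesign_le 5)
  have := Nat.card_le_card_of_injective
    (fun π : Equiv.Perm (Fin n) =>
      (⟨_, isCyclicDesign_develop_baseCycle π⟩ : {B // IsCyclicDesign (10 * n + 5) 5 B}))
    (fun π π' h => develop_baseCycle_injective (Subtype.mk.inj h))
  rwa [Nat.card_eq_fintype_card, Fintype.card_perm, Fintype.card_fin] at this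

end Construction

lemma eventually_pow_mul_le_factorial :
    ∃ N : ℕ, ∀ n, N ≤ n → (38.4 : ℝ) ^ n * (10 * n + 5) ≤ n.factorial := by
  have h := (FloorSemiring.tendsto_pow_div_factorial_atTop (76.8 : ℝ)).eventually_le_const
    (zero_lt_one)
  obtain ⟨N, hN⟩ := Filter.eventually_atTop.1 h
  refine ⟨max N 7, fun n hn => ?_⟩
  have hpow : ∀ m : ℕ, 7 ≤ m → 10 * m + 5 ≤ 2 ^ m := by
    intro m hm
    induction m, hm using Nat.le_induction with
    | base => norm_num
    | succ m hm ih => rw [pow_succ]; omega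
  have h2 : (10 * n + 5 : ℝ) ≤ 2 ^ n := by
    exact_mod_cast hpow n (le_trans (le_max_right _ _) hn)
  have h3 := (div_le_one (by positivity)).1 (hN n (le_trans (le_max_left _ _) hn))
  calc (38.4 : ℝ) ^ n * (10 * n + 5) ≤ 38.4 ^ n * 2 ^ n := by gcongr
    _ = 76.8 ^ n := by rw [← mul_pow]; norm_num
    _ ≤ _ := h3

end CCS

/-- For all sufficiently large `n ≡ 3, 5, 24, 26 (mod 28)`,
`NC(10n+5, 5) ≥ 38.4^n`. -/
theorem stmt11 : ∃ N : ℕ, ∀ n : ℕ, N ≤ n →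
    (n % 28 = 3 ∨ n % 28 = 5 ∨ n % 28 = 24 ∨ n % 28 = 26) →
    (38.4 : ℝ) ^ n ≤ (CCS.NC (10 * n + 5) 5 : ℝ) := by
  obtain ⟨N, hN⟩ := CCS.eventually_pow_mul_le_factorial
  refine ⟨N, fun n hn _ => ?_⟩
  have h1 := hN n hn
  have h2 : (n.factorial : ℝ) ≤ CCS.NC (10 * n + 5) 5 * (10 * n + 5) := by
    exact_mod_cast CCS.factorial_le_NC_mul n
  exact le_of_mul_le_mul_right (h1.trans h2) (by positivity)
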